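/- arXiv:2008.04790 — 5 statements merged into one kernel-verified Lean document; each statement's English description precedes it below -/
import Mathlib

section
/- Let f, g be strictly positive probability mass functions on a finite set S, let K ≥ 2, let α be the uniform distribution on {1,…,K}, and fix 𝒦 ⊂ {1,…,K} with |𝒦| = 2. Let Z = ∑_{x∈S} √(f(x) g(x)), h = Z^{-1} √(f g), I = D_{1/2}(f‖g) and J = ∑_{x∈S} h(x) log²(f(x)/g(x)). Define f*_ℓ = h for ℓ ∈ 𝒦 and f*_ℓ = g otherwise, and with f_{kℓ} = f if k = ℓ and f_{kℓ} = g otherwise, α*_k = (1/2)·1(k ∈ 𝒦), A_k = ∑_ℓ K^{-1} d_KL(f*_ℓ ‖ f_{kℓ}), B_k = ∑_ℓ K^{-1} d_KL(f*_ℓ ‖ f_{kℓ})² − A_k², I_21 = ∑_{k∈𝒦} ∑_ℓ α*_k K^{-1} v_KL(f*_ℓ ‖ f_{kℓ}) + ∑_{k∈𝒦} α*_k B_k, and I_22 = ∑_{k∈𝒦} α*_k A_k² − (∑_{k∈𝒦} α*_k A_k)². Then I_21 = (1/2 − 1/K) K^{-1} I² + (1/2) K^{-1} J and I_22 = 0.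 -/
open Finset

/-- Kullback–Leibler divergence between probability mass functions on a finite set. -/
noncomputable def dKL {S : Type*} [Fintype S] (p q : S → ℝ) : ℝ :=
  ∑ x, p x * Real.log (p x / q x)

/-- Variance-type KL functional `v_KL(p‖q) = ∑ p log²(p/q) − d_KL(p‖q)²`. -/
noncomputable def vKL {S : Type*} [Fintype S] (p q : S → ℝ) : ℝ :=
  (∑ x, p x * (Real.log (p x / q x)) ^ 2) - (dKL p q) ^ 2

theorem dKL_self {S : Type*} [Fintype S] {p : S → ℝ} (hp : ∀ x, 0 < p x) : dKL p p = 0 := by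
  simp [dKL, div_self (hp _).ne']

theorem vKL_self {S : Type*} [Fintype S] {p : S → ℝ} (hp : ∀ x, 0 < p x) : vKL p p = 0 := by
  simp [vKL, dKL_self hp, div_self (hp _).ne']

/-- If the log-likelihood ratio is an affine function `a + b * L`, then `dKL` is the affine function
of the mean of `L`. -/
theorem dKL_eq_of_log_eq {S : Type*} [Fintype S] {p q L : S → ℝ} {a b : ℝ}
    (hp : ∑ x, p x = 1) (hlog : ∀ x, Real.log (p x / q x) = a + b * L x) :
    dKL p q = a + b * ∑ x, p x * L x := by
  calc dKL p q = ∑ x, (a * p x + b * (p x * L x)) :=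
        Finset.sum_congr rfl fun x _ => by rw [hlog]; ring
    _ = a + b * ∑ x, p x * L x := by
        rw [Finset.sum_add_distrib, ← Finset.mul_sum, ← Finset.mul_sum, hp, mul_one]

theorem vKL_eq_of_log_eq {S : Type*} [Fintype S] {p q L : S → ℝ} {a b : ℝ}
    (hp : ∑ x, p x = 1) (hlog : ∀ x, Real.log (p x / q x) = a + b * L x) :
    vKL p q = b ^ 2 * (∑ x, p x * L x ^ 2 - (∑ x, p x * L x) ^ 2) := by
  have hsq : ∑ x, p x * Real.log (p x / q x) ^ 2 =
      a ^ 2 + 2 * a * b * ∑ x, p x * L x + b ^ 2 * ∑ x, p x * L x ^ 2 := by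
    calc ∑ x, p x * Real.log (p x / q x) ^ 2
        = ∑ x, (a ^ 2 * p x + 2 * a * b * (p x * L x) + b ^ 2 * (p x * L x ^ 2)) :=
          Finset.sum_congr rfl fun x _ => by rw [hlog]; ring
      _ = _ := by
          rw [Finset.sum_add_distrib, Finset.sum_add_distrib, ← Finset.mul_sum, ← Finset.mul_sum,
            ← Finset.mul_sum, hp, mul_one]
  rw [vKL, hsq, dKL_eq_of_log_eq hp hlog]
  ring

/-- For `k` in a two-element set `s`, a sum over block pairs that vanishes on the diagonal pair
`(g, g)` reduces to two terms. -/
theorem sum_ite_mem_eq_of_card_two {ι β : Type*} [Fintype ι] [DecidableEq ι] {s : Finset ι}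
    (hs : s.card = 2) (Φ : β → β → ℝ) {f g h : β} (hΦ : Φ g g = 0) {k : ι} (hk : k ∈ s) :
    ∑ l, Φ (if l ∈ s then h else g) (if k = l then f else g) = Φ h f + Φ h g := by
  have hsub : ∑ l ∈ s, Φ (if l ∈ s then h else g) (if k = l then f else g) =
      ∑ l, Φ (if l ∈ s then h else g) (if k = l then f else g) := by
    refine Finset.sum_subset (Finset.subset_univ s) fun l _ hl => ?_
    rw [if_neg hl, if_neg (fun hkl : k = l => hl (hkl ▸ hk)), hΦ]
  have herase : ∀ l ∈ s.erase k,
      Φ (if l ∈ s then h else g) (if k = l then f else g) = Φ h g := by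
    intro l hl
    rw [if_pos (Finset.mem_of_mem_erase hl), if_neg (Finset.ne_of_mem_erase hl).symm]
  rw [← hsub, ← Finset.add_sum_erase s _ hk, Finset.sum_congr rfl herase, if_pos hk, if_pos rfl,
    Finset.sum_const, Finset.card_erase_of_mem hk, hs]
  simp

/-- Values of the variance terms `I₂₁` and `I₂₂` for a uniform homogeneous SBM when the
reference distributions are chosen optimally. -/
theorem variance_terms_uniform_homogeneous
    (K : ℕ) (hK : 2 ≤ K) (S : Type*) [Fintype S]
    (f g : S → ℝ) (hfpos : ∀ x, 0 < f x) (hgpos : ∀ x, 0 < g x)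
    (hf1 : ∑ x, f x = 1) (hg1 : ∑ x, g x = 1)
    (𝒦 : Finset (Fin K)) (h𝒦card : 𝒦.card = 2)
    (Z I J : ℝ) (h : S → ℝ)
    (hZ : Z = ∑ x, Real.sqrt (f x * g x))
    (hh : ∀ x, h x = Z⁻¹ * Real.sqrt (f x * g x))
    (hI : I = -2 * Real.log Z)
    (hJ : J = ∑ x, h x * (Real.log (f x / g x)) ^ 2)
    (fstar : Fin K → S → ℝ)
    (hfstar : ∀ l, fstar l = if l ∈ 𝒦 then h else g)
    (αstar : Fin K → ℝ)
    (hαstar : ∀ k, αstar k = (1 / 2) * (if k ∈ 𝒦 then 1 else 0))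
    (A B : Fin K → ℝ)
    (hA : ∀ k, A k = ∑ l, (K : ℝ)⁻¹ * dKL (fstar l) (if k = l then f else g))
    (hB : ∀ k, B k =
      (∑ l, (K : ℝ)⁻¹ * (dKL (fstar l) (if k = l then f else g)) ^ 2) - (A k) ^ 2)
    (I21 I22 : ℝ)
    (hI21 : I21 =
      (∑ k ∈ 𝒦, ∑ l, αstar k * (K : ℝ)⁻¹ * vKL (fstar l) (if k = l then f else g)) +
        ∑ k ∈ 𝒦, αstar k * B k)
    (hI22 : I22 = (∑ k ∈ 𝒦, αstar k * (A k) ^ 2) - (∑ k ∈ 𝒦, αstar k * A k) ^ 2) :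
    I21 = (1 / 2 - (K : ℝ)⁻¹) * (K : ℝ)⁻¹ * I ^ 2 + (1 / 2) * (K : ℝ)⁻¹ * J ∧
    I22 = 0 := by
  have hS : Nonempty S := by
    by_contra hS
    rw [not_nonempty_iff] at hS
    simp at hf1
  have hsqrt : ∀ x, 0 < Real.sqrt (f x * g x) := fun x =>
    Real.sqrt_pos.2 (mul_pos (hfpos x) (hgpos x))
  have hZpos : 0 < Z := hZ ▸ Finset.sum_pos (fun x _ => hsqrt x) Finset.univ_nonempty
  have hsum : ∑ x, h x = 1 := by
    simp_rw [hh]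
    rw [← Finset.mul_sum, ← hZ, inv_mul_cancel₀ hZpos.ne']
  have hhpos : ∀ x, 0 < h x := fun x => by
    rw [hh]
    exact mul_pos (inv_pos.2 hZpos) (hsqrt x)
  have hlogh : ∀ x, Real.log (h x) = I / 2 + (Real.log (f x) + Real.log (g x)) / 2 := by
    intro x
    rw [hh, Real.log_mul (inv_pos.2 hZpos).ne' (hsqrt x).ne', Real.log_inv,
      Real.log_sqrt (mul_pos (hfpos x) (hgpos x)).le,
      Real.log_mul (hfpos x).ne' (hgpos x).ne', hI]
    ring
  have hlogf : ∀ x, Real.log (h x / f x) = I / 2 + (-1 / 2) * Real.log (f x / g x) := by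
    intro x
    rw [Real.log_div (hhpos x).ne' (hfpos x).ne', Real.log_div (hfpos x).ne' (hgpos x).ne', hlogh]
    ring
  have hlogg : ∀ x, Real.log (h x / g x) = I / 2 + (1 / 2) * Real.log (f x / g x) := by
    intro x
    rw [Real.log_div (hhpos x).ne' (hgpos x).ne', Real.log_div (hfpos x).ne' (hgpos x).ne', hlogh]
    ring
  have hdf := dKL_eq_of_log_eq hsum hlogf
  have hdg := dKL_eq_of_log_eq hsum hlogg
  have hvf := vKL_eq_of_log_eq hsum hlogf
  have hvg := vKL_eq_of_log_eq hsum hlogg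
  rw [← hJ] at hvf hvg
  set m := ∑ x, h x * Real.log (f x / g x)
  have hα : ∀ k ∈ 𝒦, αstar k = 1 / 2 := fun k hk => by rw [hαstar, if_pos hk, mul_one]
  have hAk : ∀ k ∈ 𝒦, A k = (K : ℝ)⁻¹ * I := by
    intro k hk
    simp_rw [hA, hfstar]
    rw [sum_ite_mem_eq_of_card_two h𝒦card (fun p q => (K : ℝ)⁻¹ * dKL p q)
      (by simp [dKL_self hgpos]) hk, hdf, hdg]
    ring
  have hBk : ∀ k ∈ 𝒦, B k = (K : ℝ)⁻¹ * (I ^ 2 / 2 + m ^ 2 / 2) - ((K : ℝ)⁻¹ * I) ^ 2 := by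
    intro k hk
    rw [hB, hAk k hk]
    simp_rw [hfstar]
    rw [sum_ite_mem_eq_of_card_two h𝒦card (fun p q => (K : ℝ)⁻¹ * dKL p q ^ 2)
      (by simp [dKL_self hgpos]) hk, hdf, hdg]
    ring
  have hVk : ∀ k ∈ 𝒦, ∑ l, αstar k * (K : ℝ)⁻¹ * vKL (fstar l) (if k = l then f else g) =
      (1 / 2) * (K : ℝ)⁻¹ * (J / 2 - m ^ 2 / 2) := by
    intro k hk
    rw [hα k hk]
    simp_rw [hfstar]
    rw [sum_ite_mem_eq_of_card_two h𝒦card (fun p q => 1 / 2 * (K : ℝ)⁻¹ * vKL p q)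
      (by simp [vKL_self hgpos]) hk, hvf, hvg]
    ring
  have hmean : ∀ (X : Fin K → ℝ) (c : ℝ), (∀ k ∈ 𝒦, X k = c) → ∑ k ∈ 𝒦, αstar k * X k = c := by
    intro X c hX
    have hterm : ∀ k ∈ 𝒦, αstar k * X k = 1 / 2 * c := fun k hk => by rw [hα k hk, hX k hk]
    rw [Finset.sum_congr rfl hterm, Finset.sum_const, h𝒦card]
    simp
  constructor
  · rw [hI21, Finset.sum_congr rfl hVk, hmean B _ hBk, Finset.sum_const, h𝒦card]
    simp only [nsmul_eq_mul, Nat.cast_ofNat]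
    ring
  · rw [hI22, hmean A _ hAk, hmean (fun k => A k ^ 2) _ (fun k hk => by rw [hAk k hk]), sub_self]
end

section
/- Let f, g be strictly positive probability mass functions on a finite set S, let Z = ∑_{x∈S} √(f(x) g(x)), I = −2 log Z, and J = Z^{-1} ∑_{x∈S} √(f(x) g(x)) · log²(f(x)/g(x)). Then J ≤ 8 (e^{I/2} − 1); in particular, J ≤ 14 I whenever I ≤ 1. -/
open Finset

theorem one_add_sq_div_two_le_cosh (u : ℝ) : 1 + u ^ 2 / 2 ≤ Real.cosh u := by
  have h : (u / 2) ^ 2 ≤ Real.sinh (u / 2) ^ 2 := by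
    rw [sq_le_sq, Real.abs_sinh]
    exact Real.self_le_sinh_iff.2 (abs_nonneg _)
  have h2 := Real.cosh_two_mul (u / 2)
  rw [mul_div_cancel₀ u two_ne_zero] at h2
  linarith [Real.cosh_sq (u / 2)]

theorem two_mul_sqrt_mul_add_le_add {a b : ℝ} (ha : 0 < a) (hb : 0 < b) :
    2 * √(a * b) + √(a * b) * Real.log (a / b) ^ 2 / 4 ≤ a + b := by
  have hcosh : 2 * √(a * b) * Real.cosh (Real.log (a / b) / 2) = a + b := by
    rw [Real.cosh_eq, ← neg_div, ← Real.log_inv, Real.exp_half, Real.exp_half,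
      Real.exp_log (by positivity), Real.exp_log (by positivity)]
    calc 2 * √(a * b) * ((√(a / b) + √((a / b)⁻¹)) / 2)
        = √(a * b) * √(a / b) + √(a * b) * √((a / b)⁻¹) := by ring
      _ = √(a ^ 2) + √(b ^ 2) := by
        rw [← Real.sqrt_mul (by positivity), ← Real.sqrt_mul (by positivity)]
        congr 2 <;> field_simp
      _ = a + b := by rw [Real.sqrt_sq ha.le, Real.sqrt_sq hb.le]
  rw [← hcosh]
  have := mul_le_mul_of_nonneg_left
    (one_add_sq_div_two_le_cosh (Real.log (a / b) / 2)) (Real.sqrt_nonneg (a * b))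
  linarith

theorem exp_sub_one_le_two_mul {x : ℝ} (hx : x ≤ 1 / 2) (hx0 : 0 ≤ x) :
    Real.exp x - 1 ≤ 2 * x := by
  have h : Real.exp x * (1 - x) ≤ 1 := by
    calc Real.exp x * (1 - x) ≤ Real.exp x * Real.exp (-x) := by
          gcongr
          exact Real.one_sub_le_exp_neg x
      _ = 1 := by rw [← Real.exp_add, add_neg_cancel, Real.exp_zero]
  have h2 : Real.exp x ≤ 2 := by nlinarith [Real.exp_pos x]
  nlinarith

/-- If `Z = ∑ √(fg)`, `I = −2 log Z` and `J = Z⁻¹ ∑ √(fg) log²(f/g)`, then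
`J ≤ 8(e^{I/2} − 1)`; in particular `J ≤ 14 I` whenever `I ≤ 1`. -/
theorem J_bounded_by_I
    (S : Type*) [Fintype S] (f g : S → ℝ)
    (hfpos : ∀ x, 0 < f x) (hgpos : ∀ x, 0 < g x)
    (hf1 : ∑ x, f x = 1) (hg1 : ∑ x, g x = 1)
    (Z I J : ℝ)
    (hZ : Z = ∑ x, Real.sqrt (f x * g x))
    (hI : I = -2 * Real.log Z)
    (hJ : J = Z⁻¹ * ∑ x, Real.sqrt (f x * g x) * (Real.log (f x / g x)) ^ 2) :
    J ≤ 8 * (Real.exp (I / 2) - 1) ∧ (I ≤ 1 → J ≤ 14 * I) := by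
  have hne : (univ : Finset S).Nonempty := nonempty_of_sum_ne_zero (hf1 ▸ one_ne_zero)
  have hZpos : 0 < Z :=
    hZ ▸ sum_pos (fun x _ => Real.sqrt_pos.2 (mul_pos (hfpos x) (hgpos x))) hne
  have hZJ : Z * J = ∑ x, √(f x * g x) * Real.log (f x / g x) ^ 2 := by
    rw [hJ, mul_inv_cancel_left₀ hZpos.ne']
  have hmain : 2 * Z + Z * J / 4 ≤ 2 := by
    have h := sum_le_sum fun x (_ : x ∈ univ) =>
      two_mul_sqrt_mul_add_le_add (hfpos x) (hgpos x)
    rw [sum_add_distrib, sum_add_distrib, ← mul_sum, ← sum_div, ← hZ, ← hZJ, hf1, hg1] at h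
    linarith
  have hZJ0 : 0 ≤ Z * J := hZJ ▸ sum_nonneg fun x _ => by positivity
  have hexp : Real.exp (I / 2) = Z⁻¹ := by
    rw [hI, show -2 * Real.log Z / 2 = -Real.log Z by ring, Real.exp_neg, Real.exp_log hZpos]
  have hbound : J ≤ 8 * (Real.exp (I / 2) - 1) := by
    rw [hexp]
    refine le_of_mul_le_mul_left ?_ hZpos
    have : Z * (8 * (Z⁻¹ - 1)) = 8 - 8 * Z := by field_simp
    linarith
  refine ⟨hbound, fun hI1 => ?_⟩
  have hI0 : 0 ≤ I := by
    linarith [Real.log_nonpos hZpos.le (by linarith : Z ≤ 1)]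
  linarith [exp_sub_one_le_two_mul (x := I / 2) (by linarith) (by linarith)]
end

section
/- Let S be a finite set and f, g strictly positive probability mass functions on S with f ≠ g. Let σ : {1,…,N} → {1,…,K} be a node labelling, fix a node i, and let X_{ij}, j ≠ i, be independent S-valued random variables with law f when σ(j) = σ(i) and law g otherwise. Let σ̃_i : {1,…,N}\{i} → {1,…,K} be a fixed labelling, let d*_i = min over permutations τ of {1,…,K} of #{j ≠ i : τ(σ̃_i(j)) ≠ σ(j)}, let τ be a permutation attaining this minimum, and let N_min = min_k |σ^{-1}(k)|. For k ∈ {1,…,K} set h_i(k) = ∑_{j ≠ i, σ̃_i(j) = k} log(f(X_{ij})/g(X_{ij})), and let σ̂_i(i) be any random variable that almost surely maximises k ↦ h_i(k). Then for every r ∈ (0,1): P(τ(σ̂_i(i)) ≠ σ(i)) ≤ K · exp(−(N_min − 1 − 2 d*_i − (2r/(1−r)) d*_i β_r) · 2 (1−r) D_r^s(f,g)), where D_α^s(f,g) = (D_α(f‖g) + D_α(g‖f))/2 is the symmetric Rényi divergence and β_r = D_{1+r}^s(f,g) / D_r^s(f,g). -/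
open Finset

/-- Hamming distance between two node labellings. -/
def ham {N K : ℕ} (σ₁ σ₂ : Fin N → Fin K) : ℕ :=
  (Finset.univ.filter fun i => σ₁ i ≠ σ₂ i).card

/-- Number of nodes with label `k` under the labelling `σ`. -/
def blockCount {N K : ℕ} (σ : Fin N → Fin K) (k : Fin K) : ℕ :=
  (Finset.univ.filter fun i => σ i = k).card

/-- Rényi divergence of order `a` between probability mass functions on a finite set. -/
noncomputable def renyiDiv {S : Type*} [Fintype S] (a : ℝ) (p q : S → ℝ) : ℝ :=
  (a - 1)⁻¹ * Real.log (∑ x, p x ^ a * q x ^ (1 - a))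

/-- The log-likelihood score `h_i(k)` of label `k` for node `i`, based on the labelling `σt`
of the other nodes and the observed interactions `X`. -/
noncomputable def hScore {N K : ℕ} {S : Type*} [Fintype S] (f g : S → ℝ) (i : Fin N)
    (σt : {j : Fin N // j ≠ i} → Fin K) (X : {j : Fin N // j ≠ i} → S) (k : Fin K) : ℝ :=
  ∑ j ∈ Finset.univ.filter (fun j : {j : Fin N // j ≠ i} => σt j = k),
    Real.log (f (X j) / g (X j))

/-- The exponential moment of a log-likelihood ratio under the denominator law. -/
lemma mul_exp_mul_log_div {a b : ℝ} (ha : 0 < a) (hb : 0 < b) (t : ℝ) :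
    b * Real.exp (t * Real.log (a / b)) = a ^ t * b ^ (1 - t) := by
  rw [Real.rpow_def_of_pos ha, Real.rpow_def_of_pos hb, Real.log_div ha.ne' hb.ne']
  nth_rw 1 [← Real.exp_log hb]
  rw [← Real.exp_add, ← Real.exp_add]
  congr 1
  ring

/-- The exponential moment of a log-likelihood ratio under the numerator law. -/
lemma mul_exp_mul_log_div_self {a b : ℝ} (ha : 0 < a) (hb : 0 < b) (t : ℝ) :
    a * Real.exp (t * Real.log (a / b)) = a ^ (1 + t) * b ^ (1 - (1 + t)) := by
  rw [Real.rpow_def_of_pos ha, Real.rpow_def_of_pos hb, Real.log_div ha.ne' hb.ne']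
  nth_rw 1 [← Real.exp_log ha]
  rw [← Real.exp_add, ← Real.exp_add]
  congr 1
  ring

section

variable {S : Type*} [Fintype S] {p q : S → ℝ}

lemma sum_rpow_mul_rpow_le_one (hp : ∀ x, 0 < p x) (hq : ∀ x, 0 < q x)
    (hp1 : ∑ x, p x = 1) (hq1 : ∑ x, q x = 1) {t : ℝ} (ht0 : 0 ≤ t) (ht1 : t ≤ 1) :
    ∑ x, p x ^ t * q x ^ (1 - t) ≤ 1 :=
  calc ∑ x, p x ^ t * q x ^ (1 - t) ≤ ∑ x, (t * p x + (1 - t) * q x) :=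
        Finset.sum_le_sum fun x _ => Real.geom_mean_le_arith_mean2_weighted ht0 (by linarith)
          (hp x).le (hq x).le (by ring)
    _ = 1 := by
        rw [Finset.sum_add_distrib, ← Finset.mul_sum, ← Finset.mul_sum, hp1, hq1]
        ring

lemma one_le_sum_rpow_mul_rpow (hp : ∀ x, 0 < p x) (hq : ∀ x, 0 < q x)
    (hp1 : ∑ x, p x = 1) (hq1 : ∑ x, q x = 1) {t : ℝ} (ht : 1 ≤ t) :
    1 ≤ ∑ x, p x ^ t * q x ^ (1 - t) :=
  calc 1 = ∑ x, (q x + t * (p x - q x)) := by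
        rw [Finset.sum_add_distrib, ← Finset.mul_sum, Finset.sum_sub_distrib, hp1, hq1]
        ring
    _ ≤ ∑ x, p x ^ t * q x ^ (1 - t) := by
        refine Finset.sum_le_sum fun x _ => ?_
        have hbern := one_add_mul_self_le_rpow_one_add (s := p x / q x - 1)
          (by linarith [div_pos (hp x) (hq x)]) ht
        have hmul := mul_le_mul_of_nonneg_left hbern (hq x).le
        have hrpow : q x * (1 + (p x / q x - 1)) ^ t = p x ^ t * q x ^ (1 - t) := by
          rw [add_sub_cancel, Real.div_rpow (hp x).le (hq x).le, Real.rpow_sub (hq x),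
            Real.rpow_one]
          ring
        rw [hrpow] at hmul
        refine le_trans (le_of_eq ?_) hmul
        have hqx := (hq x).ne'
        field_simp

lemma renyiDiv_nonneg (hp : ∀ x, 0 < p x) (hq : ∀ x, 0 < q x)
    (hp1 : ∑ x, p x = 1) (hq1 : ∑ x, q x = 1) {t : ℝ} (ht : 0 ≤ t) : 0 ≤ renyiDiv t p q := by
  unfold renyiDiv
  rcases le_total t 1 with ht1 | ht1
  · refine mul_nonneg_of_nonpos_of_nonpos (inv_nonpos.2 (by linarith)) (Real.log_nonpos ?_
      (sum_rpow_mul_rpow_le_one hp hq hp1 hq1 ht ht1))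
    exact Finset.sum_nonneg fun x _ =>
      mul_nonneg (Real.rpow_nonneg (hp x).le _) (Real.rpow_nonneg (hq x).le _)
  · exact mul_nonneg (inv_nonneg.2 (by linarith))
      (Real.log_nonneg (one_le_sum_rpow_mul_rpow hp hq hp1 hq1 ht1))

lemma sum_rpow_mul_rpow_pos [Nonempty S] (hp : ∀ x, 0 < p x) (hq : ∀ x, 0 < q x) (t : ℝ) :
    0 < ∑ x, p x ^ t * q x ^ (1 - t) :=
  Finset.sum_pos (fun x _ => mul_pos (Real.rpow_pos_of_pos (hp x) _)
    (Real.rpow_pos_of_pos (hq x) _)) Finset.univ_nonempty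

/-- The union bound for a finite nonnegative weight. -/
lemma sum_filter_le_sum_sum_filter {α κ : Type*} [Fintype α] {w : α → ℝ} (hw : ∀ x, 0 ≤ w x)
    (s : Finset κ) (E : α → Prop) (F : κ → α → Prop) [DecidablePred E]
    [∀ k, DecidablePred (F k)] (h : ∀ x, E x → ∃ k ∈ s, F k x) :
    ∑ x ∈ Finset.univ.filter E, w x ≤ ∑ k ∈ s, ∑ x ∈ Finset.univ.filter (F k), w x := by
  simp_rw [Finset.sum_filter]
  rw [Finset.sum_comm]
  refine Finset.sum_le_sum fun x _ => ?_
  have hterm (k : κ) : 0 ≤ if F k x then w x else 0 := by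
    split_ifs
    exacts [hw x, le_rfl]
  split_ifs with hx
  · obtain ⟨k, hk, hF⟩ := h x hx
    refine le_trans (le_of_eq ?_) (Finset.single_le_sum (fun k _ => hterm k) hk)
    rw [if_pos hF]
  · exact Finset.sum_nonneg fun k _ => hterm k

/-- Chernoff's bound for a product measure on a finite product space. -/
lemma sum_filter_prod_le_exp_sum {ι : Type*} [Fintype ι] [DecidableEq ι]
    {P : ι → S → ℝ} (hP : ∀ j x, 0 ≤ P j x) (u : ι → S → ℝ) (c : ι → ℝ)
    (hc : ∀ j, ∑ x, P j x * Real.exp (u j x) ≤ Real.exp (c j)) (E : (ι → S) → Prop)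
    [DecidablePred E] (hE : ∀ X, E X → 0 ≤ ∑ j, u j (X j)) :
    ∑ X ∈ Finset.univ.filter E, ∏ j, P j (X j) ≤ Real.exp (∑ j, c j) :=
  calc ∑ X ∈ Finset.univ.filter E, ∏ j, P j (X j)
      ≤ ∑ X ∈ Finset.univ.filter E, ∏ j, (P j (X j) * Real.exp (u j (X j))) := by
        refine Finset.sum_le_sum fun X hX => ?_
        rw [Finset.prod_mul_distrib, ← Real.exp_sum]
        exact le_mul_of_one_le_right (Finset.prod_nonneg fun j _ => hP j _)
          (Real.one_le_exp (hE X (Finset.mem_filter.1 hX).2))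
    _ ≤ ∑ X : ι → S, ∏ j, (P j (X j) * Real.exp (u j (X j))) :=
        Finset.sum_le_sum_of_subset_of_nonneg (Finset.filter_subset _ _) fun X _ _ =>
          Finset.prod_nonneg fun j _ => mul_nonneg (hP j _) (Real.exp_pos _).le
    _ = ∏ j, ∑ x, P j x * Real.exp (u j x) :=
        (Fintype.prod_sum fun j x => P j x * Real.exp (u j x)).symm
    _ ≤ ∏ j, Real.exp (c j) :=
        Finset.prod_le_prod (fun j _ => Finset.sum_nonneg fun x _ =>
          mul_nonneg (hP j x) (Real.exp_pos _).le) fun j _ => hc j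
    _ = Real.exp (∑ j, c j) := (Real.exp_sum _ _).symm

end

lemma card_filter_subtype_ne_eq {N K : ℕ} (σ : Fin N → Fin K) (i : Fin N) (k : Fin K) :
    (((Finset.univ.filter fun j : {j : Fin N // j ≠ i} => σ j.1 = k).card : ℕ) : ℝ)
      = blockCount σ k - if σ i = k then 1 else 0 := by
  have hsplit := Fintype.sum_eq_add_sum_subtype_ne (fun j => if σ j = k then (1 : ℝ) else 0) i
  rw [blockCount, Finset.card_filter, Finset.card_filter]
  push_cast
  linarith

/-- The probability that a wrong label `k` scores at least as high as the correct label `k₀`. -/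
lemma sum_filter_hScore_le_exp {N K : ℕ} {S : Type*} [Fintype S] {f g : S → ℝ}
    (hf : ∀ x, 0 < f x) (hg : ∀ x, 0 < g x)
    (hf1 : ∑ x, f x = 1) (hg1 : ∑ x, g x = 1) (σ : Fin N → Fin K) (i : Fin N)
    (σt : {j : Fin N // j ≠ i} → Fin K) (τ : Equiv.Perm (Fin K)) {k k₀ : Fin K}
    (hk₀ : τ k₀ = σ i) (hk : k ≠ k₀) {r : ℝ} (hr0 : 0 < r) (hr1 : r < 1)
    [DecidablePred fun X => hScore f g i σt X k₀ ≤ hScore f g i σt X k] :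
    (∑ X ∈ Finset.univ.filter (fun X : {j : Fin N // j ≠ i} → S =>
        hScore f g i σt X k₀ ≤ hScore f g i σt X k),
        ∏ j : {j : Fin N // j ≠ i}, (if σ j.1 = σ i then f (X j) else g (X j)))
      ≤ Real.exp (-((blockCount σ (τ k) : ℝ) * ((1 - r) * renyiDiv r f g))
          - ((blockCount σ (σ i) : ℝ) - 1) * ((1 - r) * renyiDiv r g f)
          + ((Finset.univ.filter fun j : {j : Fin N // j ≠ i} => τ (σt j) ≠ σ j.1).card : ℝ)
            * ((1 - r) * renyiDiv r f g + (1 - r) * renyiDiv r g f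
              + r * renyiDiv (1 + r) f g + r * renyiDiv (1 + r) g f)) := by
  classical
  have : Nonempty S := by
    by_contra hS
    rw [not_nonempty_iff] at hS
    simp at hf1
  have hr1' : r - 1 ≠ 0 := by linarith
  have below (p q : S → ℝ) : (1 - r) * renyiDiv r p q
      = -Real.log (∑ x, p x ^ r * q x ^ (1 - r)) := by
    unfold renyiDiv
    field_simp
    ring
  have above (p q : S → ℝ) : r * renyiDiv (1 + r) p q
      = Real.log (∑ x, p x ^ (1 + r) * q x ^ (1 - (1 + r))) := by
    unfold renyiDiv
    rw [add_sub_cancel_left, mul_inv_cancel_left₀ hr0.ne']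
  have exp_below {p q : S → ℝ} (hp : ∀ x, 0 < p x) (hq : ∀ x, 0 < q x) :
      ∑ x, q x * Real.exp (r * Real.log (p x / q x))
        = Real.exp (-((1 - r) * renyiDiv r p q)) := by
    rw [below, neg_neg, Real.exp_log (sum_rpow_mul_rpow_pos hp hq r)]
    exact Finset.sum_congr rfl fun x _ => mul_exp_mul_log_div (hp x) (hq x) r
  have exp_above {p q : S → ℝ} (hp : ∀ x, 0 < p x) (hq : ∀ x, 0 < q x) :
      ∑ x, p x * Real.exp (r * Real.log (p x / q x))
        = Real.exp (r * renyiDiv (1 + r) p q) := by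
    rw [above, Real.exp_log (sum_rpow_mul_rpow_pos hp hq (1 + r))]
    exact Finset.sum_congr rfl fun x _ => mul_exp_mul_log_div_self (hp x) (hq x) r
  have ha : 0 ≤ (1 - r) * renyiDiv r f g :=
    mul_nonneg (by linarith) (renyiDiv_nonneg hf hg hf1 hg1 (by linarith))
  have hb : 0 ≤ (1 - r) * renyiDiv r g f :=
    mul_nonneg (by linarith) (renyiDiv_nonneg hg hf hg1 hf1 (by linarith))
  have hA : 0 ≤ r * renyiDiv (1 + r) f g :=
    mul_nonneg (by linarith) (renyiDiv_nonneg hf hg hf1 hg1 (by linarith))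
  have hB : 0 ≤ r * renyiDiv (1 + r) g f :=
    mul_nonneg (by linarith) (renyiDiv_nonneg hg hf hg1 hf1 (by linarith))
  have hea := exp_below hf hg
  have heb := exp_below hg hf
  have heA := exp_above hf hg
  have heB := exp_above hg hf
  generalize (1 - r) * renyiDiv r f g = a at *
  generalize (1 - r) * renyiDiv r g f = b at *
  generalize r * renyiDiv (1 + r) f g = A at *
  generalize r * renyiDiv (1 + r) g f = B at *
  refine (sum_filter_prod_le_exp_sum
    (P := fun (j : {j : Fin N // j ≠ i}) x => if σ j.1 = σ i then f x else g x)
    (fun j x => by split_ifs; exacts [(hf x).le, (hg x).le])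
    (fun j x => if σt j = k then r * Real.log (f x / g x)
      else if σt j = k₀ then r * Real.log (g x / f x) else 0)
    (fun j => if σt j = k then (if σ j.1 = σ i then A else -a)
      else if σt j = k₀ then (if σ j.1 = σ i then -b else B) else 0)
    (fun j => ?_) _ fun X hX => ?_).trans (Real.exp_le_exp.2 ?_)
  · by_cases h : σ j.1 = σ i
    · simp only [h, if_true]
      split_ifs
      exacts [heA.le, heb.le, by simp [hf1]]
    · simp only [h, if_false]
      split_ifs
      exacts [hea.le, heB.le, by simp [hg1]]
  · have hscore : ∑ j : {j : Fin N // j ≠ i}, (if σt j = k then r * Real.log (f (X j) / g (X j))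
        else if σt j = k₀ then r * Real.log (g (X j) / f (X j)) else 0)
        = r * (hScore f g i σt X k - hScore f g i σt X k₀) := by
      unfold hScore
      rw [Finset.sum_filter, Finset.sum_filter, ← Finset.sum_sub_distrib, Finset.mul_sum]
      refine Finset.sum_congr rfl fun j _ => ?_
      have hlog : Real.log (g (X j) / f (X j)) = -Real.log (f (X j) / g (X j)) := by
        rw [← Real.log_inv, inv_div]
      rw [hlog]
      by_cases h1 : σt j = k
      · simp [h1, hk]
      · by_cases h2 : σt j = k₀ <;> simp [h1, h2, hk.symm]
    rw [hscore]
    exact mul_nonneg hr0.le (sub_nonneg.2 hX)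
  · have hτk : σ i ≠ τ k := fun h => hk (τ.injective (by rw [← h, hk₀]))
    have hcardk := card_filter_subtype_ne_eq σ i (τ k)
    have hcard₀ := card_filter_subtype_ne_eq σ i (σ i)
    rw [if_neg hτk, sub_zero] at hcardk
    rw [if_pos rfl] at hcard₀
    rw [← hcardk, ← hcard₀, Finset.card_filter, Finset.card_filter, Finset.card_filter]
    push_cast
    rw [Finset.sum_mul, Finset.sum_mul, Finset.sum_mul, ← Finset.sum_neg_distrib,
      ← Finset.sum_sub_distrib, ← Finset.sum_add_distrib]
    refine Finset.sum_le_sum fun j _ => ?_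
    by_cases h1 : σt j = k
    · have hne : σ j.1 = σ i → τ k ≠ σ j.1 := fun h h' => hτk (h.symm.trans h'.symm)
      simp only [h1, if_true]
      split_ifs <;> first | linarith | grind
    · by_cases h2 : σt j = k₀
      · simp only [h2, hk₀, hk.symm, if_true, if_false]
        split_ifs <;> first | linarith | grind
      · have hne : τ (σt j) ≠ τ k := fun h => h1 (τ.injective h)
        have hne₀ : τ (σt j) ≠ σ i := fun h => h2 (τ.injective (h.trans hk₀.symm))
        simp only [h1, h2, if_false]
        split_ifs <;> first | linarith | grind

/-- Error bound for estimating the label of a single node `i` by maximising the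
log-likelihood score computed from a possibly corrupted labelling `σt` of the other nodes. -/
theorem single_node_label_estimation_error
    (N K : ℕ) [NeZero K] (S : Type*) [Fintype S]
    (f g : S → ℝ) (hfpos : ∀ x, 0 < f x) (hgpos : ∀ x, 0 < g x)
    (hf1 : ∑ x, f x = 1) (hg1 : ∑ x, g x = 1) (hfg : f ≠ g)
    (σ : Fin N → Fin K) (i : Fin N)
    (σt : {j : Fin N // j ≠ i} → Fin K)
    (dstar : ℕ)
    (hdstar : dstar = Finset.univ.inf' Finset.univ_nonempty
      (fun ρ : Equiv.Perm (Fin K) =>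
        (Finset.univ.filter fun j : {j : Fin N // j ≠ i} => ρ (σt j) ≠ σ j.1).card))
    (τ : Equiv.Perm (Fin K))
    (hτ : (Finset.univ.filter fun j : {j : Fin N // j ≠ i} => τ (σt j) ≠ σ j.1).card = dstar)
    (Nmin : ℕ)
    (hNmin : Nmin = Finset.univ.inf' Finset.univ_nonempty fun k => blockCount σ k)
    (σhat : ({j : Fin N // j ≠ i} → S) → Fin K)
    (hmax : ∀ X : {j : Fin N // j ≠ i} → S, ∀ k : Fin K,
      hScore f g i σt X k ≤ hScore f g i σt X (σhat X))
    (r : ℝ) (hr0 : 0 < r) (hr1 : r < 1)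
    (Drs βr : ℝ)
    (hDrs : Drs = (renyiDiv r f g + renyiDiv r g f) / 2)
    (hβr : βr = ((renyiDiv (1 + r) f g + renyiDiv (1 + r) g f) / 2) / Drs) :
    (∑ X ∈ Finset.univ.filter (fun X : {j : Fin N // j ≠ i} → S => τ (σhat X) ≠ σ i),
        ∏ j : {j : Fin N // j ≠ i}, (if σ j.1 = σ i then f (X j) else g (X j)))
      ≤ (K : ℝ) * Real.exp
          (-((Nmin : ℝ) - 1 - 2 * (dstar : ℝ) - (2 * r / (1 - r)) * (dstar : ℝ) * βr) *
            (2 * (1 - r) * Drs)) := by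
  classical
  have hP (j : {j : Fin N // j ≠ i}) (x : S) : 0 ≤ if σ j.1 = σ i then f x else g x := by
    split_ifs
    exacts [(hfpos x).le, (hgpos x).le]
  have hK : (1 : ℝ) ≤ K := by exact_mod_cast NeZero.one_le
  by_cases hD : Drs = 0
  · have hone := sum_filter_prod_le_exp_sum hP (fun _ _ => 0) (fun _ => 0)
      (fun j => by split_ifs <;> simp [hf1, hg1]) (fun X => τ (σhat X) ≠ σ i) (by simp)
    simp only [Finset.sum_const_zero, Real.exp_zero] at hone
    simpa [hD] using hone.trans hK
  have hr1' : 1 - r ≠ 0 := by linarith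
  obtain ⟨k₀, hk₀⟩ := τ.surjective (σ i)
  have hNle (k : Fin K) : (Nmin : ℝ) ≤ blockCount σ k := by
    rw [hNmin]
    exact_mod_cast Finset.inf'_le _ (Finset.mem_univ k)
  have hfg₁ := renyiDiv_nonneg hfpos hgpos hf1 hg1 hr0.le
  have hgf₁ := renyiDiv_nonneg hgpos hfpos hg1 hf1 hr0.le
  have hfg₂ := renyiDiv_nonneg hfpos hgpos hf1 hg1 (t := 1 + r) (by linarith)
  have hgf₂ := renyiDiv_nonneg hgpos hfpos hg1 hf1 (t := 1 + r) (by linarith)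
  have hexponent : -((Nmin : ℝ) - 1 - 2 * (dstar : ℝ) - (2 * r / (1 - r)) * (dstar : ℝ) * βr) *
      (2 * (1 - r) * Drs) = -((Nmin : ℝ) - 1 - 2 * dstar) *
        ((1 - r) * renyiDiv r f g + (1 - r) * renyiDiv r g f)
        + 2 * dstar * (r * renyiDiv (1 + r) f g + r * renyiDiv (1 + r) g f) := by
    have hβD : βr * Drs = (renyiDiv (1 + r) f g + renyiDiv (1 + r) g f) / 2 := by
      rw [hβr, div_mul_cancel₀ _ hD]
    have hrr : 2 * r / (1 - r) * (1 - r) = 2 * r := div_mul_cancel₀ _ hr1'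
    linear_combination (2 * (dstar : ℝ) * βr * Drs) * hrr + (4 * r * (dstar : ℝ)) * hβD
      - 2 * ((Nmin : ℝ) - 1 - 2 * dstar) * (1 - r) * hDrs
  rw [hexponent]
  have hlabel (k : Fin K) (hk : k ≠ k₀) :=
    sum_filter_hScore_le_exp hfpos hgpos hf1 hg1 σ i σt τ hk₀ hk hr0 hr1
  have hwrong (X : {j : Fin N // j ≠ i} → S) (hX : τ (σhat X) ≠ σ i) : σhat X ≠ k₀ :=
    fun h => hX (by rw [h, hk₀])
  calc ∑ X ∈ Finset.univ.filter (fun X : {j : Fin N // j ≠ i} → S => τ (σhat X) ≠ σ i),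
        ∏ j : {j : Fin N // j ≠ i}, (if σ j.1 = σ i then f (X j) else g (X j))
      ≤ ∑ k ∈ Finset.univ.filter (· ≠ k₀), ∑ X ∈ Finset.univ.filter (fun X =>
          hScore f g i σt X k₀ ≤ hScore f g i σt X k),
          ∏ j : {j : Fin N // j ≠ i}, (if σ j.1 = σ i then f (X j) else g (X j)) :=
        sum_filter_le_sum_sum_filter (fun X => Finset.prod_nonneg fun j _ => hP j (X j)) _ _ _
          fun X hX => ⟨σhat X, Finset.mem_filter.2 ⟨Finset.mem_univ _, hwrong X hX⟩, hmax X k₀⟩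
    _ ≤ ∑ k ∈ Finset.univ.filter (· ≠ k₀), Real.exp (-((Nmin : ℝ) - 1 - 2 * dstar) *
          ((1 - r) * renyiDiv r f g + (1 - r) * renyiDiv r g f)
          + 2 * dstar * (r * renyiDiv (1 + r) f g + r * renyiDiv (1 + r) g f)) := by
        refine Finset.sum_le_sum fun k hk =>
          (hlabel k (Finset.mem_filter.1 hk).2).trans (Real.exp_le_exp.2 ?_)
        rw [hτ]
        have ha := mul_nonneg (sub_nonneg.2 hr1.le) hfg₁
        have hb := mul_nonneg (sub_nonneg.2 hr1.le) hgf₁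
        have hA := mul_nonneg hr0.le hfg₂
        have hB := mul_nonneg hr0.le hgf₂
        have hd : (0 : ℝ) ≤ dstar := Nat.cast_nonneg _
        linarith [mul_le_mul_of_nonneg_right (hNle (τ k)) ha,
          mul_le_mul_of_nonneg_right (hNle (σ i)) hb, mul_nonneg hd ha, mul_nonneg hd hb,
          mul_nonneg hd hA, mul_nonneg hd hB]
    _ ≤ _ := by
        rw [Finset.sum_const, nsmul_eq_mul]
        refine mul_le_mul_of_nonneg_right ?_ (Real.exp_pos _).le
        exact_mod_cast (Finset.card_le_univ _).trans_eq (Fintype.card_fin K)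
end

section
/- Fix an integer T ≥ 1. For a, b ∈ {0,1} and integers j, t, let c_{jt}(ab) be the number of binary sequences x ∈ {0,1}^T with x_on = j, ‖x‖ = t, x_1 = a and x_T = b. Then the nonzero values of c_{jt}(ab) are exactly the following: c_{00}(00) = 1; for j = 1: c_{1t}(00) = T − t − 1 for 1 ≤ t ≤ T − 2, c_{1t}(01) = c_{1t}(10) = 1 for 1 ≤ t ≤ T − 1, and c_{1T}(11) = 1; and for 2 ≤ j ≤ ⌈T/2⌉ and j ≤ t ≤ T − 1 − j + a + b: c_{jt}(ab) = C(t−1, j−1) · C(T−t−1, j−a−b), where C(·,·) denotes the binomial coefficient. -/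
open Finset

/-- Number of `a → b` transitions in the binary sequence `x` of length `T`. -/
def transCount (T : ℕ) (x : Fin T → Bool) (a b : Bool) : ℕ :=
  (Finset.univ.filter fun t : Fin (T - 1) =>
    x ⟨t.1, lt_of_lt_of_le t.2 (Nat.sub_le T 1)⟩ = a ∧
    x ⟨t.1 + 1, Nat.add_lt_of_lt_sub t.2⟩ = b).card

/-- Number of ones `‖x‖` in the binary sequence `x`. -/
def onesCount (T : ℕ) (x : Fin T → Bool) : ℕ :=
  (Finset.univ.filter fun t => x t = true).card

/-- First entry of the binary sequence `x`. -/
def firstBit (T : ℕ) (x : Fin T → Bool) : Bool :=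
  if h : 0 < T then x ⟨0, h⟩ else false

/-- Last entry of the binary sequence `x`. -/
def lastBit (T : ℕ) (x : Fin T → Bool) : Bool :=
  if h : 0 < T then x ⟨T - 1, Nat.sub_lt h one_pos⟩ else false

/-- Number of on-periods `x_on = x_1 + x_{01}` of the binary sequence `x`. -/
def onPeriods (T : ℕ) (x : Fin T → Bool) : ℕ :=
  (firstBit T x).toNat + transCount T x false true

/-- `c_{jt}(ab)`: the number of binary sequences of length `T` with `j` on-periods, `t` ones,
first entry `a` and last entry `b`. -/
def seqCount (T j t : ℕ) (a b : Bool) : ℕ :=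
  (Finset.univ.filter fun x : Fin T → Bool =>
    onPeriods T x = j ∧ onesCount T x = t ∧ firstBit T x = a ∧ lastBit T x = b).card

/-- Number of compositions of `n` into `k` positive parts. -/
def compCount : ℕ → ℕ → ℕ
  | 0, 0 => 1
  | 0, _ + 1 => 0
  | _ + 1, 0 => 0
  | n + 1, k + 1 => Nat.choose n k

theorem compCount_succ_succ (n k : ℕ) :
    compCount (n + 1) (k + 1) = compCount n (k + 1) + compCount n k := by
  rcases n with _ | n <;> rcases k with _ | k <;> simp [compCount, Nat.choose_succ_succ, add_comm]

theorem compCount_of_pos {n k : ℕ} (hn : 1 ≤ n) (hk : 1 ≤ k) :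
    compCount n k = Nat.choose (n - 1) (k - 1) := by
  obtain ⟨n, rfl⟩ := Nat.exists_eq_add_of_le' hn
  obtain ⟨k, rfl⟩ := Nat.exists_eq_add_of_le' hk
  rfl

theorem compCount_ne_zero {n k : ℕ} (h : compCount n k ≠ 0) :
    k ≤ n ∧ (k = 0 → n = 0) := by
  rcases n with _ | n <;> rcases k with _ | k <;> simp [compCount] at h ⊢
  by_contra! hlt
  exact h (Nat.choose_eq_zero_of_lt hlt)

section Cons

variable (n : ℕ) (a : Bool) (y : Fin (n + 1) → Bool)

theorem firstBit_cons : firstBit (n + 2) (Fin.cons a y) = a := by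
  simp only [firstBit, Nat.succ_pos, dite_true]
  rfl

theorem firstBit_eq_zero : firstBit (n + 1) y = y 0 := by
  simp only [firstBit, Nat.succ_pos, dite_true]
  rfl

theorem lastBit_cons : lastBit (n + 2) (Fin.cons a y) = lastBit (n + 1) y := by
  simp only [lastBit, Nat.succ_pos, dite_true]
  rfl

theorem onesCount_cons :
    onesCount (n + 2) (Fin.cons a y) = a.toNat + onesCount (n + 1) y := by
  simp only [onesCount, Finset.card_filter]
  rw [Fin.sum_univ_succ]
  cases a <;> simp

theorem transCount_cons (b c : Bool) :
    transCount (n + 2) (Fin.cons a y) b c =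
      (if a = b ∧ firstBit (n + 1) y = c then 1 else 0) + transCount (n + 1) y b c := by
  simp only [transCount, Finset.card_filter, firstBit_eq_zero]
  exact Fin.sum_univ_succ (n := n) _

theorem onPeriods_cons :
    onPeriods (n + 2) (Fin.cons a y) =
      onPeriods (n + 1) y + (if a = true ∧ firstBit (n + 1) y = false then 1 else 0) := by
  simp only [onPeriods, firstBit_cons, transCount_cons]
  cases a <;> cases firstBit (n + 1) y <;> simp [add_comm]

end Cons

theorem seqCount_succ_eq_sum (n j t : ℕ) (a b : Bool) :
    seqCount (n + 2) j t a b =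
      ∑ y : Fin (n + 1) → Bool,
        if onPeriods (n + 2) (Fin.cons a y) = j ∧ onesCount (n + 2) (Fin.cons a y) = t ∧
          lastBit (n + 1) y = b then 1 else 0 := by
  rw [seqCount, Finset.card_filter, ← (Fin.consEquiv fun _ : Fin (n + 2) => Bool).sum_comp,
    Fintype.sum_prod_type, Fintype.sum_bool]
  cases a <;> simp [Fin.consEquiv, firstBit_cons, lastBit_cons]

theorem seqCount_succ_false (n j t : ℕ) (b : Bool) :
    seqCount (n + 2) j t false b =
      seqCount (n + 1) j t false b + seqCount (n + 1) j t true b := by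
  rw [seqCount_succ_eq_sum, seqCount, seqCount, Finset.card_filter, Finset.card_filter,
    ← Finset.sum_add_distrib]
  refine Finset.sum_congr rfl fun y _ => ?_
  rw [onPeriods_cons, onesCount_cons]
  cases firstBit (n + 1) y <;> simp

theorem seqCount_succ_true (n j t : ℕ) (b : Bool) :
    seqCount (n + 2) (j + 1) (t + 1) true b =
      seqCount (n + 1) j t false b + seqCount (n + 1) (j + 1) t true b := by
  rw [seqCount_succ_eq_sum, seqCount, seqCount, Finset.card_filter, Finset.card_filter,
    ← Finset.sum_add_distrib]
  refine Finset.sum_congr rfl fun y _ => ?_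
  rw [onPeriods_cons, onesCount_cons]
  cases firstBit (n + 1) y <;> simp [add_comm 1]

theorem onesCount_le (T : ℕ) (x : Fin T → Bool) : onesCount T x ≤ T := by
  simpa [onesCount] using Finset.card_filter_le (Finset.univ : Finset (Fin T)) (x · = true)

theorem seqCount_eq_zero_of_lt {T t : ℕ} (h : T < t) (j : ℕ) (a b : Bool) :
    seqCount T j t a b = 0 := by
  rw [seqCount, Finset.card_eq_zero, Finset.filter_eq_empty_iff]
  rintro x - ⟨-, hx, -⟩
  have := onesCount_le T x
  omega

theorem seqCount_zero_onPeriods_true (T t : ℕ) (b : Bool) : seqCount T 0 t true b = 0 := by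
  rw [seqCount, Finset.card_eq_zero, Finset.filter_eq_empty_iff]
  rintro x - ⟨hx, -, h, -⟩
  simp [onPeriods, h] at hx

theorem seqCount_zero_ones_true (n j : ℕ) (b : Bool) : seqCount (n + 1) j 0 true b = 0 := by
  rw [seqCount, Finset.card_eq_zero, Finset.filter_eq_empty_iff]
  rintro x - ⟨-, hx, h, -⟩
  rw [onesCount, Finset.card_eq_zero, Finset.filter_eq_empty_iff] at hx
  exact hx (Finset.mem_univ 0) (by rwa [firstBit_eq_zero] at h)

theorem seqCount_one (j t : ℕ) (a b : Bool) :
    seqCount 1 j t a b = if a = b ∧ j = a.toNat ∧ t = a.toNat then 1 else 0 := by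
  rw [seqCount, Finset.card_filter, ← (Equiv.funUnique (Fin 1) Bool).symm.sum_comp,
    Fintype.sum_bool]
  rcases j with _ | _ | j <;> rcases t with _ | _ | t <;> cases a <;> cases b <;>
    simp [onPeriods, onesCount, firstBit, lastBit, transCount]

/-- A sequence is determined by its first bit together with the lengths of its runs of ones and
of its runs of zeros, which are independent compositions. -/
theorem seqCount_eq_compCount_mul (n : ℕ) : ∀ (j t u : ℕ) (a b : Bool), t + u = n + 1 →
    seqCount (n + 1) j t a b =
      compCount t j * compCount u (j + 1 - a.toNat - b.toNat) := by
  induction n with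
  | zero =>
    intro j t u a b h
    rw [seqCount_one]
    obtain ⟨rfl, rfl⟩ | ⟨rfl, rfl⟩ : (t = 0 ∧ u = 1) ∨ (t = 1 ∧ u = 0) := by omega
    all_goals
      rcases j with _ | _ | j <;> cases a <;> cases b <;> simp [compCount]
  | succ n ih =>
    intro j t u a b h
    cases a with
    | false =>
      rw [seqCount_succ_false]
      rcases u with _ | u
      · rw [seqCount_eq_zero_of_lt (by omega), seqCount_eq_zero_of_lt (by omega)]
        obtain ⟨t, rfl⟩ : ∃ s, t = s + 1 := ⟨n + 1, by omega⟩
        rcases j with _ | j <;> cases b <;> simp [compCount]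
      · rw [ih j t u _ _ (by omega), ih j t u _ _ (by omega), ← mul_add]
        rcases j with _ | j
        · rcases t with _ | t
          · obtain ⟨u, rfl⟩ : ∃ s, u = s + 1 := ⟨n, by omega⟩
            cases b <;> simp [compCount]
          · simp [compCount]
        · cases b <;> simp [compCount_succ_succ]
    | true =>
      rcases t with _ | t
      · rw [seqCount_zero_ones_true]
        obtain ⟨u, rfl⟩ : ∃ s, u = s + 1 := ⟨n + 1, by omega⟩
        rcases j with _ | j <;> simp [compCount]
      · rcases j with _ | j
        · simp [seqCount_zero_onPeriods_true, compCount]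
        · rw [seqCount_succ_true, ih _ t u _ _ (by omega), ih _ t u _ _ (by omega),
            compCount_succ_succ]
          simp
          ring

/-- Exact description of the nonzero values of the path counts `c_{jt}(ab)`. -/
theorem seqCount_values (T : ℕ) (hT : 1 ≤ T) :
    seqCount T 0 0 false false = 1 ∧
    (∀ t, 1 ≤ t → t ≤ T - 2 → seqCount T 1 t false false = T - t - 1) ∧
    (∀ t, 1 ≤ t → t ≤ T - 1 →
      seqCount T 1 t false true = 1 ∧ seqCount T 1 t true false = 1) ∧
    seqCount T 1 T true true = 1 ∧
    (∀ j t : ℕ, ∀ a b : Bool, 2 ≤ j → j ≤ (T + 1) / 2 → j ≤ t →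
      t ≤ T - 1 - j + a.toNat + b.toNat →
      seqCount T j t a b =
        Nat.choose (t - 1) (j - 1) * Nat.choose (T - t - 1) (j - a.toNat - b.toNat)) ∧
    (∀ j t : ℕ, ∀ a b : Bool, seqCount T j t a b ≠ 0 →
      (j = 0 ∧ t = 0 ∧ a = false ∧ b = false) ∨
      (j = 1 ∧ ((a = false ∧ b = false ∧ 1 ≤ t ∧ t ≤ T - 2) ∨
                (a = false ∧ b = true ∧ 1 ≤ t ∧ t ≤ T - 1) ∨
                (a = true ∧ b = false ∧ 1 ≤ t ∧ t ≤ T - 1) ∨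
                (a = true ∧ b = true ∧ t = T))) ∨
      (2 ≤ j ∧ j ≤ (T + 1) / 2 ∧ j ≤ t ∧ t ≤ T - 1 - j + a.toNat + b.toNat)) := by
  have key : ∀ (j t : ℕ) (a b : Bool), t ≤ T → seqCount T j t a b =
      compCount t j * compCount (T - t) (j + 1 - a.toNat - b.toNat) := by
    intro j t a b h
    obtain ⟨n, rfl⟩ := Nat.exists_eq_add_of_le' hT
    exact seqCount_eq_compCount_mul n j t _ a b (by omega)
  refine ⟨?_, ?_, ?_, ?_, ?_, ?_⟩
  · rw [key _ _ _ _ (Nat.zero_le _), Bool.toNat_false, compCount_of_pos (n := T - 0) (by omega)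
      (by omega)]
    simp [compCount]
  · intro t h1 h2
    rw [key _ _ _ _ (by omega), compCount_of_pos h1 le_rfl,
      compCount_of_pos (by omega) (by simp)]
    simp
  · intro t h1 h2
    rw [key _ _ _ _ (by omega), key _ _ _ _ (by omega), compCount_of_pos h1 le_rfl,
      compCount_of_pos (by omega) (by simp), compCount_of_pos (by omega) (by simp)]
    simp
  · rw [key _ _ _ _ le_rfl, compCount_of_pos hT le_rfl]
    simp [compCount]
  · intro j t a b h1 h2 h3 h4
    have ha := a.toNat_le
    have hb := b.toNat_le
    rw [key _ _ _ _ (by omega), compCount_of_pos (by omega) (by omega),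
      compCount_of_pos (by omega) (by omega)]
    congr 2
    omega
  · intro j t a b h
    have hle : t ≤ T := not_lt.1 fun hlt => h (seqCount_eq_zero_of_lt hlt j a b)
    rw [key _ _ _ _ hle] at h
    obtain ⟨h1, h2⟩ := compCount_ne_zero (left_ne_zero_of_mul h)
    obtain ⟨h3, h4⟩ := compCount_ne_zero (right_ne_zero_of_mul h)
    cases a <;> cases b <;>
      simp only [Bool.toNat_false, Bool.toNat_true, reduceCtorEq, true_and, false_and, and_true,
        and_false, false_or, or_false] at h3 h4 ⊢ <;> omega
end

section
/- Let α ∈ (0,1), let μ, ν be probability distributions on {0,1} and P, Q be 2×2 stochastic matrices, and let f, g be the corresponding Markov path distributions on {0,1}^T. Define r_a = μ_a^α ν_a^{1−α}, r̂_1 = α μ_1 + (1−α) ν_1, R_{ab} = P_{ab}^α Q_{ab}^{1−α}, and R̂_{01} = α P_{01} + (1−α) Q_{01}. Assume μ_1, ν_1, P_{01}, Q_{01} ≤ ρ for some ρ > 0 with ρT ≤ 0.01. Then D_α(f‖g) = (1−α)^{-1} ( r̂_1 − r_1 + ∑_{t=2}^T J_t + ε ) where |ε| ≤ 46 (ρT)²,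 and where J_t = R̂_{01} − R_{01} + (1 − R_{10}/(1 − R_{11})) ( R_{01} + ( r_1 (1 − R_{11}) − R_{01} ) R_{11}^{t−2} ) if R_{11} < 1, and J_t = R̂_{01} − R_{01} if R_{11} = 1. -/
open Finset

/-- Path probability of a binary Markov chain with initial distribution `μ` and transition
matrix `P`, evaluated at the path `x ∈ {0,1}^T`. -/
noncomputable def pathProb (T : ℕ) (μ : Fin 2 → ℝ) (P : Fin 2 → Fin 2 → ℝ)
    (x : Fin T → Fin 2) : ℝ :=
  (if h : 0 < T then μ (x ⟨0, h⟩) else 1) *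
    ∏ t : Fin (T - 1),
      P (x ⟨t.1, lt_of_lt_of_le t.2 (Nat.sub_le T 1)⟩)
        (x ⟨t.1 + 1, Nat.add_lt_of_lt_sub t.2⟩)

/-- Rényi divergence of order `α` between the path distributions of two binary Markov chains. -/
noncomputable def renyiPath (T : ℕ) (α : ℝ) (μ ν : Fin 2 → ℝ)
    (P Q : Fin 2 → Fin 2 → ℝ) : ℝ :=
  (α - 1)⁻¹ * Real.log (∑ x : Fin T → Fin 2, pathProb T μ P x ^ α * pathProb T ν Q x ^ (1 - α))

/-- One step of the linear recursion `v ↦ v R` on row vectors. -/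
def rowStep (R : Fin 2 → Fin 2 → ℝ) (v : Fin 2 → ℝ) : Fin 2 → ℝ :=
  fun b => ∑ a, v a * R a b

/-- Summing the weights of all paths of length `n + 1` amounts to iterating `rowStep`. -/
theorem sum_path_weight_eq_iterate (R : Fin 2 → Fin 2 → ℝ) (n : ℕ) (r : Fin 2 → ℝ) :
    ∑ x : Fin (n + 1) → Fin 2, r (x 0) * ∏ t : Fin n, R (x t.castSucc) (x t.succ) =
      ∑ b, (rowStep R)^[n] r b := by
  induction n generalizing r with
  | zero =>
    rw [← (Equiv.funUnique (Fin 1) (Fin 2)).symm.sum_comp]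
    simp
  | succ n ih =>
    rw [Function.iterate_succ_apply, ← ih, ← (Fin.consEquiv fun _ => Fin 2).sum_comp,
      Fintype.sum_prod_type, Finset.sum_comm]
    refine Finset.sum_congr rfl fun y _ => ?_
    rw [rowStep, Finset.sum_mul]
    refine Finset.sum_congr rfl fun a _ => ?_
    simp [Fin.consEquiv, Fin.prod_univ_succ, mul_assoc]

theorem pathProb_succ (n : ℕ) (μ : Fin 2 → ℝ) (P : Fin 2 → Fin 2 → ℝ)
    (x : Fin (n + 1) → Fin 2) :
    pathProb (n + 1) μ P x = μ (x 0) * ∏ t : Fin n, P (x t.castSucc) (x t.succ) := by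
  simp only [pathProb, Nat.succ_pos, dif_pos]
  rfl

theorem pathProb_rpow_mul_rpow (n : ℕ) (α β : ℝ) {μ ν : Fin 2 → ℝ} {P Q : Fin 2 → Fin 2 → ℝ}
    (hμ : ∀ a, 0 ≤ μ a) (hν : ∀ a, 0 ≤ ν a) (hP : ∀ a b, 0 ≤ P a b) (hQ : ∀ a b, 0 ≤ Q a b)
    (x : Fin (n + 1) → Fin 2) :
    pathProb (n + 1) μ P x ^ α * pathProb (n + 1) ν Q x ^ β =
      (μ (x 0) ^ α * ν (x 0) ^ β) * ∏ t : Fin n,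
        (P (x t.castSucc) (x t.succ) ^ α * Q (x t.castSucc) (x t.succ) ^ β) := by
  rw [pathProb_succ, pathProb_succ, Real.mul_rpow (hμ _) (Finset.prod_nonneg fun _ _ => hP _ _),
    Real.mul_rpow (hν _) (Finset.prod_nonneg fun _ _ => hQ _ _),
    ← Real.finsetProd_rpow _ _ (fun _ _ => hP _ _),
    ← Real.finsetProd_rpow _ _ (fun _ _ => hQ _ _), Finset.prod_mul_distrib]
  ring

/-- A weighted geometric mean of two numbers close to `1` differs from the arithmetic mean only to
second order. -/
theorem geom_mean_bounds_near_one {α ρ a b : ℝ} (hα0 : 0 < α) (hα1 : α < 1) (hρ : ρ ≤ 1 / 2)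
    (ha : 1 - ρ ≤ a) (ha1 : a ≤ 1) (hb : 1 - ρ ≤ b) (hb1 : b ≤ 1) :
    1 - ρ ≤ a ^ α * b ^ (1 - α) ∧ α * a + (1 - α) * b - ρ ^ 2 ≤ a ^ α * b ^ (1 - α) := by
  have ha0 : 0 < a := by linarith
  have hb0 : 0 < b := by linarith
  have hα1' : 0 < 1 - α := by linarith
  constructor
  · calc 1 - ρ = (1 - ρ) ^ α * (1 - ρ) ^ (1 - α) := by
          rw [← Real.rpow_add (by linarith)]; simp
      _ ≤ _ := by
          have : 0 ≤ 1 - ρ := by linarith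
          gcongr
  · have hG : 0 < a ^ α * b ^ (1 - α) := by positivity
    have h := Real.geom_mean_le_arith_mean2_weighted hα0.le hα1'.le (inv_nonneg.2 ha0.le)
      (inv_nonneg.2 hb0.le) (by ring)
    rw [Real.inv_rpow ha0.le, Real.inv_rpow hb0.le, ← mul_inv,
      inv_le_iff_one_le_mul₀ hG] at h
    set G := a ^ α * b ^ (1 - α)
    have h2 : a * b ≤ (α * b + (1 - α) * a) * G := by
      have h3 : a * b * ((α * a⁻¹ + (1 - α) * b⁻¹) * G) = (α * b + (1 - α) * a) * G := by
        field_simp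
      rw [← h3]
      exact le_mul_of_one_le_right (by positivity) h
    have hM : 1 / 2 ≤ α * b + (1 - α) * a := by nlinarith
    have hab : (a - b) ^ 2 ≤ ρ ^ 2 := sq_le_sq' (by linarith) (by linarith)
    have hαα : α * (1 - α) ≤ 1 / 4 := by nlinarith [sq_nonneg (α - 1 / 2)]
    have h4 : α * (1 - α) * (a - b) ^ 2 ≤ 1 / 4 * ρ ^ 2 := by gcongr
    have h5 : 1 / 2 * ρ ^ 2 ≤ (α * b + (1 - α) * a) * ρ ^ 2 := by gcongr
    refine le_of_mul_le_mul_left ?_ (lt_of_lt_of_le (by norm_num) hM)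
    nlinarith [sq_nonneg ρ]

/-- First-order expansion of the total mass of a nearly stationary two-state linear recursion. -/
theorem mass_expansion {ρ B δ A s₀₀ s₀₁ s₁₀ s₁₁ : ℝ} {x y h : ℕ → ℝ} {N : ℕ}
    (hρ0 : 0 ≤ ρ) (hB : B = ρ * N * ρ)
    (hx0 : 0 ≤ x 0) (hx0' : 1 - ρ ≤ x 0) (hy0 : 0 ≤ y 0) (hxy0 : x 0 + y 0 ≤ 1)
    (hx : ∀ n, x (n + 1) = x n * s₀₀ + y n * s₁₀)
    (hy : ∀ n, y (n + 1) = x n * s₀₁ + y n * s₁₁)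
    (hh0 : h 0 = y 0) (hh : ∀ n, h (n + 1) = s₀₁ + s₁₁ * h n)
    (h00 : 1 - ρ ≤ s₀₀) (h00' : 0 ≤ s₀₀) (h01 : 0 ≤ s₀₁) (h01' : s₀₁ ≤ ρ)
    (h10 : 0 ≤ s₁₀) (h11 : 0 ≤ s₁₁)
    (hrow0 : s₀₀ + s₀₁ ≤ 1) (hrow1 : s₁₀ + s₁₁ ≤ 1)
    (hδ : 1 - s₀₀ - s₀₁ = A + δ) (hδ0 : 0 ≤ δ) (n : ℕ) (hn : n ≤ N) :
    0 ≤ x n ∧ 0 ≤ y n ∧ x n + y n ≤ 1 ∧ 1 - (n + 1) * ρ ≤ x n ∧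
    (y n ≤ h n) ∧
    (1 - x n - y n) ≤ (1 - x 0 - y 0) + ∑ i ∈ Finset.range n, (A + (1 - s₁₀ - s₁₁) * h i) +
      n * δ ∧
    (1 - x 0 - y 0) + ∑ i ∈ Finset.range n, (A + (1 - s₁₀ - s₁₁) * h i) +
      (h n - y n) - 2 * n * B ≤ 1 - x n - y n := by
  induction n with
  | zero => simp [hh0, hx0, hy0, hxy0, hx0']
  | succ n ih =>
    obtain ⟨ix, iy, ixy, ix1, ih1, iu, il⟩ := ih (by omega)
    rw [Finset.sum_range_succ, hx, hy, hh]
    push_cast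
    have hnN : (n : ℝ) + 1 ≤ N := by exact_mod_cast hn
    have hxN : 1 - x n ≤ ρ * N := by nlinarith
    have hx1 : 0 ≤ 1 - x n := by linarith
    have hρN : 0 ≤ ρ * N := hx1.trans hxN
    have e1 : (1 - x n) * s₀₁ ≤ B := hB ▸ mul_le_mul hxN h01' h01 hρN
    have e2 : (1 - x n) * (A + δ) ≤ B :=
      hB ▸ mul_le_mul hxN (by linarith) (by linarith) hρN
    have e1' : 0 ≤ (1 - x n) * s₀₁ := by positivity
    have e2' : 0 ≤ (1 - x n) * (A + δ) := mul_nonneg hx1 (by linarith)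
    have d0 : 0 ≤ h n - y n := by linarith
    have e3 : 0 ≤ s₁₁ * (h n - y n) := by positivity
    have e4 : 0 ≤ s₁₀ * (h n - y n) := by positivity
    have e5 : 0 ≤ (1 - s₁₀ - s₁₁) * (h n - y n) := mul_nonneg (by linarith) d0
    have e6 : 0 ≤ x n * (1 - s₀₀ - s₀₁) := mul_nonneg ix (by linarith)
    have e7 : 0 ≤ y n * (1 - s₁₀ - s₁₁) := mul_nonneg iy (by linarith)
    have e8 : x n * (1 - s₀₀) ≤ 1 * ρ :=
        mul_le_mul (by linarith) (by linarith) (by linarith) zero_le_one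
    have e9 : 0 ≤ y n * s₁₀ := by positivity
    have key : 1 - (x n * s₀₀ + y n * s₁₀) - (x n * s₀₁ + y n * s₁₁) =
        (1 - x n - y n) + (A + (1 - s₁₀ - s₁₁) * h n) + δ - (1 - x n) * (A + δ)
          - (1 - s₁₀ - s₁₁) * (h n - y n) := by
      linear_combination (x n) * hδ
    refine ⟨by positivity, by positivity, by linarith, by linarith, by linarith, ?_, ?_⟩
    · rw [key]; linarith
    · rw [key]; linarith


/-- Sparse-regime expansion of the order-`α` Rényi divergence between binary Markov chain
path distributions, with error term bounded by `46 (ρT)²`. -/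
theorem renyi_divergence_sparse_markov_chains
    (T : ℕ) (hT : 1 ≤ T) (α : ℝ) (hα0 : 0 < α) (hα1 : α < 1)
    (μ ν : Fin 2 → ℝ) (hμ0 : ∀ a, 0 ≤ μ a) (hν0 : ∀ a, 0 ≤ ν a)
    (hμ1 : ∑ a, μ a = 1) (hν1 : ∑ a, ν a = 1)
    (P Q : Fin 2 → Fin 2 → ℝ) (hP0 : ∀ a b, 0 ≤ P a b) (hQ0 : ∀ a b, 0 ≤ Q a b)
    (hP1 : ∀ a, ∑ b, P a b = 1) (hQ1 : ∀ a, ∑ b, Q a b = 1)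
    (ρ : ℝ) (hρ0 : 0 < ρ) (hρT : ρ * T ≤ 0.01)
    (hμρ : μ 1 ≤ ρ) (hνρ : ν 1 ≤ ρ) (hPρ : P 0 1 ≤ ρ) (hQρ : Q 0 1 ≤ ρ)
    (r1 rhat1 Rhat01 : ℝ) (R : Fin 2 → Fin 2 → ℝ)
    (hr1 : r1 = μ 1 ^ α * ν 1 ^ (1 - α))
    (hrhat1 : rhat1 = α * μ 1 + (1 - α) * ν 1)
    (hR : ∀ a b, R a b = P a b ^ α * Q a b ^ (1 - α))
    (hRhat01 : Rhat01 = α * P 0 1 + (1 - α) * Q 0 1)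
    (J : ℕ → ℝ)
    (hJ : ∀ t : ℕ, J t =
      if R 1 1 < 1 then
        Rhat01 - R 0 1 +
          (1 - R 1 0 / (1 - R 1 1)) *
            (R 0 1 + (r1 * (1 - R 1 1) - R 0 1) * R 1 1 ^ (t - 2))
      else Rhat01 - R 0 1) :
    ∃ ε : ℝ, |ε| ≤ 46 * (ρ * T) ^ 2 ∧
      renyiPath T α μ ν P Q =
        (1 - α)⁻¹ * (rhat1 - r1 + (∑ t ∈ Finset.Icc 2 T, J t) + ε) := by
  obtain ⟨n, rfl⟩ : ∃ n, T = n + 1 := ⟨T - 1, by omega⟩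
  have hα1' : 0 < 1 - α := by linarith
  simp only [Fin.sum_univ_two] at hμ1 hν1
  simp only [Fin.sum_univ_two] at hP1 hQ1
  have hρ1 : ρ ≤ 0.01 := by
    push_cast at hρT
    have : 0 ≤ ρ * n := by positivity
    linarith
  have amgm : ∀ a b : ℝ, 0 ≤ a → 0 ≤ b → a ^ α * b ^ (1 - α) ≤ α * a + (1 - α) * b :=
    fun a b ha hb =>
      Real.geom_mean_le_arith_mean2_weighted hα0.le hα1'.le ha hb (by ring)
  have hR0 : ∀ a b, 0 ≤ R a b := fun a b => by
    rw [hR]; exact mul_nonneg (Real.rpow_nonneg (hP0 a b) _) (Real.rpow_nonneg (hQ0 a b) _)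
  have hRle : ∀ a b, R a b ≤ α * P a b + (1 - α) * Q a b := fun a b => by
    rw [hR]; exact amgm _ _ (hP0 a b) (hQ0 a b)
  have hrow : ∀ a, R a 0 + R a 1 ≤ 1 := fun a => by
    have e : (α * P a 0 + (1 - α) * Q a 0) + (α * P a 1 + (1 - α) * Q a 1) = 1 := by
      linear_combination α * hP1 a + (1 - α) * hQ1 a
    linarith [hRle a 0, hRle a 1]
  set r : Fin 2 → ℝ := fun a => μ a ^ α * ν a ^ (1 - α) with hr
  have hr0 : ∀ a, 0 ≤ r a := fun a =>
    mul_nonneg (Real.rpow_nonneg (hμ0 a) _) (Real.rpow_nonneg (hν0 a) _)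
  have hrle : ∀ a, r a ≤ α * μ a + (1 - α) * ν a := fun a => amgm _ _ (hμ0 a) (hν0 a)
  have hrr : r1 = r 1 := hr1
  have hr01 : (α * μ 0 + (1 - α) * ν 0) = 1 - rhat1 := by
    rw [hrhat1]; linear_combination α * hμ1 + (1 - α) * hν1
  have hR00 : (α * P 0 0 + (1 - α) * Q 0 0) = 1 - Rhat01 := by
    rw [hRhat01]; linear_combination α * hP1 0 + (1 - α) * hQ1 0
  obtain ⟨hx0', hxδ⟩ : 1 - ρ ≤ r 0 ∧ α * μ 0 + (1 - α) * ν 0 - ρ ^ 2 ≤ r 0 :=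
    geom_mean_bounds_near_one hα0 hα1 (by linarith) (by linarith) (by linarith [hμ0 1])
      (by linarith) (by linarith [hν0 1])
  obtain ⟨h00, hRδ⟩ : 1 - ρ ≤ R 0 0 ∧ α * P 0 0 + (1 - α) * Q 0 0 - ρ ^ 2 ≤ R 0 0 := by
    rw [hR]
    exact geom_mean_bounds_near_one hα0 hα1 (by linarith) (by linarith [hP1 0])
      (by linarith [hP1 0, hP0 0 1]) (by linarith [hQ1 0]) (by linarith [hQ1 0, hQ0 0 1])
  have hRhat01ρ : Rhat01 ≤ ρ := by rw [hRhat01]; nlinarith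
  have hsum : ∑ x : Fin (n + 1) → Fin 2,
      pathProb (n + 1) μ P x ^ α * pathProb (n + 1) ν Q x ^ (1 - α) =
      (rowStep R)^[n] r 0 + (rowStep R)^[n] r 1 := by
    rw [← Fin.sum_univ_two, ← sum_path_weight_eq_iterate]
    refine Finset.sum_congr rfl fun x _ => ?_
    rw [pathProb_rpow_mul_rpow n α (1 - α) hμ0 hν0 hP0 hQ0]
    simp only [hr, hR]
  let h : ℕ → ℝ := fun k => Nat.rec r1 (fun _ v => R 0 1 + R 1 1 * v) k
  have hh : ∀ k, h (k + 1) = R 0 1 + R 1 1 * h k := fun _ => rfl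
  have hJh : ∀ k, J (k + 2) = (Rhat01 - R 0 1) + (1 - R 1 0 - R 1 1) * h k := fun k => by
    rw [hJ, Nat.add_sub_cancel]
    split_ifs with h11
    · have hc : 1 - R 1 1 ≠ 0 := by linarith
      have hclosed : (1 - R 1 1) * h k = R 0 1 + (r1 * (1 - R 1 1) - R 0 1) * R 1 1 ^ k := by
        induction k with
        | zero => rw [show h 0 = r1 from rfl]; ring
        | succ k ih => rw [hh, pow_succ]; linear_combination R 1 1 * ih
      rw [← hclosed]
      field_simp
      ring
    · have h10 : 1 - R 1 0 - R 1 1 = 0 := by linarith [hrow 1, hR0 1 0]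
      rw [h10]; ring
  have hJsum : ∑ t ∈ Finset.Icc 2 (n + 1), J t =
      ∑ i ∈ Finset.range n, ((Rhat01 - R 0 1) + (1 - R 1 0 - R 1 1) * h i) := by
    rw [← Finset.Ico_add_one_right_eq_Icc, Finset.sum_Ico_eq_sum_range]
    refine Finset.sum_congr (by congr 1) fun i _ => ?_
    rw [add_comm 2 i, hJh]
  have hT0 : ρ ^ 2 ≤ (ρ * (n + 1 : ℕ)) ^ 2 := by
    refine pow_le_pow_left₀ hρ0.le ?_ 2
    exact le_mul_of_one_le_right hρ0.le (by exact_mod_cast hT)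
  obtain ⟨ix, iy, ixy, ix1, ih1, iu, il⟩ :=
    mass_expansion (x := fun k => (rowStep R)^[k] r 0) (y := fun k => (rowStep R)^[k] r 1) (h := h)
      (N := n + 1) (B := ρ * (n + 1 : ℕ) * ρ) (A := Rhat01 - R 0 1)
      (δ := (1 - R 0 0) - Rhat01) hρ0.le rfl (hr0 0) hx0' (hr0 1)
      (by
        have e0 := hrle 0
        have e1 := hrle 1
        simp only [Function.iterate_zero, id]
        linarith)
      (fun k => by rw [Function.iterate_succ_apply']; simp [rowStep])
      (fun k => by rw [Function.iterate_succ_apply']; simp [rowStep])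
      hrr hh h00 (hR0 0 0) (hR0 0 1) (by linarith [hRle 0 1]) (hR0 1 0) (hR0 1 1)
      (hrow 0) (hrow 1) (by ring) (by linarith [hRle 0 0]) n (by omega)
  simp only [Function.iterate_zero, id] at ix iy ixy ix1 ih1 iu il
  rw [← hJsum, ← hrr] at iu il
  have hZ : renyiPath (n + 1) α μ ν P Q =
      (1 - α)⁻¹ * -Real.log ((rowStep R)^[n] r 0 + (rowStep R)^[n] r 1) := by
    rw [renyiPath, hsum, ← neg_sub 1 α, inv_neg]; ring
  generalize (rowStep R)^[n] r 0 = x at *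
  generalize (rowStep R)^[n] r 1 = y at *
  generalize ∑ t ∈ Finset.Icc 2 (n + 1), J t = S at *
  refine ⟨-Real.log (x + y) - (rhat1 - r1 + S), ?_, by rw [hZ]; ring⟩
  push_cast at *
  have hn0 : (0 : ℝ) ≤ n := n.cast_nonneg
  have hZpos : 0.99 ≤ x + y := by linarith
  have l1 : Real.log (x + y) ≤ x + y - 1 := Real.log_le_sub_one_of_pos (by linarith)
  have l2 := Real.one_sub_inv_le_log_of_pos (show 0 < x + y by linarith)
  have l3 : (x + y)⁻¹ - 1 ≤ (1 - x - y) + 2 * (ρ * (n + 1)) ^ 2 := by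
    have hz : (1 - x - y) ^ 2 ≤ (ρ * (n + 1)) ^ 2 :=
      pow_le_pow_left₀ (by linarith) (by linarith) 2
    rw [sub_le_iff_le_add, inv_le_iff_one_le_mul₀ (by linarith)]
    nlinarith [sq_nonneg (ρ * (n + 1))]
  have hδn : (n : ℝ) * (1 - R 0 0 - Rhat01) ≤ n * ρ ^ 2 :=
    mul_le_mul_of_nonneg_left (by linarith) hn0
  have b1 : (n : ℝ) * ρ ^ 2 ≤ (ρ * (n + 1)) ^ 2 := by
    have : 0 ≤ ρ ^ 2 + n * ρ ^ 2 + n * (n * ρ ^ 2) := by positivity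
    linear_combination this
  have b2 : 2 * (n : ℝ) * (ρ * (n + 1) * ρ) ≤ 2 * (ρ * (n + 1)) ^ 2 := by
    have : 0 ≤ 2 * (ρ ^ 2 + n * ρ ^ 2) := by positivity
    linear_combination this
  have hr00 := hrle 0
  rw [abs_le]
  constructor <;> linarith [sq_nonneg (ρ * (n + 1))]
end
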